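/- arXiv:2405.15100 — 2 statements merged into one kernel-verified Lean document; each statement's English description precedes it below -/
import Mathlib

section
/- Let r > 0, let γ : [0,1] → ℝ² be a continuous rectifiable path of length ℓ, and let V₁, …, V_k be pairwise disjoint Lebesgue-measurable subsets of ℝ², each of positive finite area, such that for each i there is a point c_i ∈ ℝ² with V_i ⊆ B(c_i, r), and the image of γ intersects each V_i. For each i let ρ_i = √(area(V_i)/π), and let ρ̄ = (ρ₁ + ⋯ + ρ_k)/k be the average radius. Then k · π ρ̄² ≤ Σ_{i=1}^{k} π ρ_i² ≤ 4rℓ + 4πr²; in particular k ≤ (4r/(π ρ̄²)) (ℓ + πr). -/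
open MeasureTheory Metric Set

/-- `rhoOf V` is the radius of a disc whose area equals the area of `V`. -/
noncomputable def rhoOf (V : Set (EuclideanSpace ℝ (Fin 2))) : ℝ :=
  Real.sqrt ((volume V).toReal / Real.pi)

theorem measurableSet_shifted_disc_diff (R d : ℝ) :
    MeasurableSet
      {z : ℝ × ℝ | (z.1 - d) ^ 2 + z.2 ^ 2 ≤ R ^ 2 ∧ R ^ 2 < z.1 ^ 2 + z.2 ^ 2} := by
  rw [Set.ofPred_and]
  exact (measurableSet_le (by fun_prop) (by fun_prop)).inter
    (measurableSet_lt (by fun_prop) (by fun_prop))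

/-- The part of a disc not covered by its translate in the direction of the first axis,
for discs given in coordinates. -/
theorem volume_prod_shifted_disc_diff_le (R d : ℝ) (hd : 0 ≤ d) :
    volume {z : ℝ × ℝ | (z.1 - d) ^ 2 + z.2 ^ 2 ≤ R ^ 2 ∧ R ^ 2 < z.1 ^ 2 + z.2 ^ 2} ≤
      ENNReal.ofReal d * ENNReal.ofReal (2 * |R|) := by
  have hS := measurableSet_shifted_disc_diff R d
  rw [Measure.volume_eq_prod, Measure.prod_apply_symm hS]
  have hslice : ∀ y : ℝ, volume ((fun x : ℝ => (x, y)) ⁻¹'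
      {z : ℝ × ℝ | (z.1 - d) ^ 2 + z.2 ^ 2 ≤ R ^ 2 ∧ R ^ 2 < z.1 ^ 2 + z.2 ^ 2}) ≤
      (Set.Icc (-|R|) |R|).indicator (fun _ => ENNReal.ofReal d) y := by
    intro y
    by_cases hy : y ∈ Set.Icc (-|R|) |R|
    · rw [Set.indicator_of_mem hy]
      have hy2 : y ^ 2 ≤ R ^ 2 := sq_le_sq.2 (abs_le.2 hy)
      set w := Real.sqrt (R ^ 2 - y ^ 2) with hw
      have hw0 : 0 ≤ w := Real.sqrt_nonneg _
      have hw2 : w ^ 2 = R ^ 2 - y ^ 2 := Real.sq_sqrt (by linarith)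
      calc _ ≤ volume (Set.Icc w (w + d)) := by
            refine measure_mono ?_
            rintro x ⟨h1, h2⟩
            simp only at h1 h2
            have h3 : |x - d| ≤ w := abs_le_of_sq_le_sq (by linarith) hw0
            have h4 : w < |x| := lt_of_pow_lt_pow_left₀ 2 (abs_nonneg _) (by
              rw [sq_abs]; linarith)
            obtain ⟨h5, h6⟩ := abs_le.1 h3
            rcases lt_abs.1 h4 with h7 | h7
            · exact ⟨h7.le, by linarith⟩
            · linarith
        _ = ENNReal.ofReal d := by rw [Real.volume_Icc]; ring_nf
    · rw [Set.indicator_of_notMem hy, nonpos_iff_eq_zero]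
      convert! measure_empty (μ := (volume : Measure ℝ))
      refine Set.eq_empty_of_forall_notMem ?_
      rintro x ⟨h1, -⟩
      simp only at h1
      exact hy (abs_le.1 (sq_le_sq.1 (by nlinarith [sq_nonneg (x - d)])))
  refine (lintegral_mono hslice).trans_eq ?_
  rw [lintegral_indicator measurableSet_Icc, setLIntegral_const, Real.volume_Icc]
  ring_nf

/-- Moving a disc of radius `R` by a distance `d` adds a region of area at most `2 R d`. -/
theorem volume_closedBall_diff_closedBall_le (p q : EuclideanSpace ℝ (Fin 2)) (R : ℝ)
    (hR : 0 ≤ R) :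
    volume (closedBall q R \ closedBall p R) ≤ ENNReal.ofReal (2 * R) * edist q p := by
  rcases eq_or_ne q p with rfl | hqp
  · simp
  set d := ‖q - p‖ with hd
  have hd0 : 0 < d := norm_pos_iff.2 (sub_ne_zero.2 hqp)
  have hv : Orthonormal ℝ
      (({0} : Set (Fin 2)).domRestrict (fun _ => d⁻¹ • (q - p))) := by
    refine ⟨fun i => ?_, fun i j hij => (hij (Subsingleton.elim i j)).elim⟩
    simp [norm_smul, ← hd, abs_of_pos hd0, hd0.ne']
  obtain ⟨b, hb⟩ := hv.exists_orthonormalBasis_extension_of_card_eq (by simp)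
  have hqd : q - p = d • b 0 := by
    rw [hb 0 rfl, smul_smul, mul_inv_cancel₀ hd0.ne', one_smul]
  have hmp : MeasurePreserving (fun x : EuclideanSpace ℝ (Fin 2) =>
      (b.repr (x - p) 0, b.repr (x - p) 1)) volume volume :=
    (volume_preserving_finTwoArrow ℝ).comp ((PiLp.volume_preserving_ofLp (Fin 2)).comp
      (b.measurePreserving_repr.comp (measurePreserving_sub_right volume p)))
  have hS := measurableSet_shifted_disc_diff R d
  have hnorm : ∀ y : EuclideanSpace ℝ (Fin 2), ‖y‖ ^ 2 = b.repr y 0 ^ 2 + b.repr y 1 ^ 2 := by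
    intro y
    rw [← b.repr.norm_map y, EuclideanSpace.norm_sq_eq, Fin.sum_univ_two]
    simp
  have hsub : closedBall q R \ closedBall p R ⊆
      (fun x : EuclideanSpace ℝ (Fin 2) => (b.repr (x - p) 0, b.repr (x - p) 1)) ⁻¹'
      {z : ℝ × ℝ | (z.1 - d) ^ 2 + z.2 ^ 2 ≤ R ^ 2 ∧ R ^ 2 < z.1 ^ 2 + z.2 ^ 2} := by
    rintro x ⟨hxq, hxp⟩
    rw [mem_closedBall, dist_eq_norm] at hxq hxp
    have hq : b.repr (x - q) = b.repr (x - p) - d • b.repr (b 0) := by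
      rw [← map_smul, ← map_sub, ← hqd]
      congr 1
      abel
    have h1 : ‖x - q‖ ^ 2 ≤ R ^ 2 := pow_le_pow_left₀ (norm_nonneg _) hxq 2
    have h2 : R ^ 2 < ‖x - p‖ ^ 2 := pow_lt_pow_left₀ (not_le.1 hxp) hR two_ne_zero
    rw [hnorm] at h1 h2
    rw [hq] at h1
    refine ⟨?_, h2⟩
    simpa using h1
  calc _ ≤ _ := measure_mono hsub
    _ = _ := hmp.measure_preimage hS.nullMeasurableSet
    _ ≤ _ := volume_prod_shifted_disc_diff_le R d hd0.le
    _ = _ := by rw [edist_dist, dist_eq_norm, ← hd, abs_of_nonneg hR, mul_comm]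

/-- The area of the union of discs of radius `R` centred at the vertices of a polygonal path
is bounded in terms of the length of the path. -/
theorem volume_biUnion_closedBall_le (u : ℕ → EuclideanSpace ℝ (Fin 2)) (R : ℝ) (hR : 0 ≤ R)
    (n : ℕ) :
    volume (⋃ i ∈ Finset.range (n + 1), closedBall (u i) R) ≤
      ENNReal.ofReal (R ^ 2 * Real.pi) +
        ENNReal.ofReal (2 * R) * ∑ i ∈ Finset.range n, edist (u (i + 1)) (u i) := by
  induction n with
  | zero =>
    simp [EuclideanSpace.volume_closedBall_fin_two, ENNReal.ofReal_mul, ENNReal.ofReal_pow, hR]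
  | succ n ih =>
    rw [Finset.sum_range_succ, mul_add, ← add_assoc]
    calc _ ≤ volume ((⋃ i ∈ Finset.range (n + 1), closedBall (u i) R) ∪
          (closedBall (u (n + 1)) R \ closedBall (u n) R)) := by
          refine measure_mono fun x hx => ?_
          simp only [Set.mem_iUnion, Finset.mem_range, exists_prop] at hx
          obtain ⟨i, hi, hx⟩ := hx
          simp only [Set.mem_union, Set.mem_iUnion, Finset.mem_range, exists_prop, Set.mem_sdiff]
          rcases Nat.lt_succ_iff_lt_or_eq.1 hi with hi | rfl
          · exact Or.inl ⟨i, hi, hx⟩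
          · by_cases hxn : x ∈ closedBall (u n) R
            · exact Or.inl ⟨n, n.lt_succ_self, hxn⟩
            · exact Or.inr ⟨hx, hxn⟩
      _ ≤ _ := measure_union_le _ _
      _ ≤ _ := add_le_add ih (volume_closedBall_diff_closedBall_le _ _ R hR)

/-- The area of the union of discs of radius `R` centred at finitely many points of a path
of bounded variation. -/
theorem volume_iUnion_closedBall_path_le {k : ℕ} (γ : ℝ → EuclideanSpace ℝ (Fin 2)) (s : Set ℝ)
    (t : Fin k → ℝ) (ht : ∀ i, t i ∈ s) (R : ℝ) (hR : 0 ≤ R) :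
    volume (⋃ i, closedBall (γ (t i)) R) ≤
      ENNReal.ofReal (R ^ 2 * Real.pi) + ENNReal.ofReal (2 * R) * eVariationOn γ s := by
  obtain _ | n := k
  · simp
  let u : ℕ → ℝ := fun i => t (Tuple.sort t ⟨min i n, by omega⟩)
  have hu : Monotone u := fun i j hij =>
    Tuple.monotone_sort t (Fin.mk_le_mk.2 (min_le_min_right n hij))
  calc _ ≤ volume (⋃ i ∈ Finset.range (n + 1), closedBall (γ (u i)) R) := by
        refine measure_mono (Set.iUnion_subset fun i x hx => ?_)
        simp only [Set.mem_iUnion, Finset.mem_range, exists_prop]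
        refine ⟨(Tuple.sort t).symm i, ((Tuple.sort t).symm i).2, ?_⟩
        have : (⟨min ((Tuple.sort t).symm i : ℕ) n, by omega⟩ : Fin (n + 1)) =
            (Tuple.sort t).symm i := Fin.ext (min_eq_left (by omega))
        simpa [u, this] using hx
    _ ≤ _ := volume_biUnion_closedBall_le (fun i => γ (u i)) R hR n
    _ ≤ _ := by
        gcongr
        exact eVariationOn.sum_le hu fun i => ht _

theorem pi_mul_rhoOf_sq (V : Set (EuclideanSpace ℝ (Fin 2))) :
    Real.pi * rhoOf V ^ 2 = (volume V).toReal := by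
  rw [rhoOf, Real.sq_sqrt (by positivity), mul_div_cancel₀ _ Real.pi_ne_zero]

/-- If a continuous rectifiable path of length `ℓ` visits `k` pairwise disjoint
measurable sets of positive finite area, each contained in some disc of radius `r`,
then with `ρ_i = √(area(V_i)/π)` and `ρ̄` the average of the `ρ_i`, one has
`k·πρ̄² ≤ Σ πρ_i² ≤ 4rℓ + 4πr²`, and in particular `k ≤ (4r/(πρ̄²))(ℓ + πr)`. -/
theorem card_disjoint_regions_visited_le (r ℓ : ℝ) (hr : 0 < r) (k : ℕ)
    (γ : ℝ → EuclideanSpace ℝ (Fin 2))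
    (hcont : ContinuousOn γ (Set.Icc 0 1))
    (hrect : eVariationOn γ (Set.Icc 0 1) ≠ ⊤)
    (hlen : ℓ = (eVariationOn γ (Set.Icc 0 1)).toReal)
    (V : Fin k → Set (EuclideanSpace ℝ (Fin 2)))
    (c : Fin k → EuclideanSpace ℝ (Fin 2))
    (hdisj : ∀ i j : Fin k, i ≠ j → Disjoint (V i) (V j))
    (hmeas : ∀ i, MeasurableSet (V i))
    (hpos : ∀ i, 0 < volume (V i))
    (hfin : ∀ i, volume (V i) < ⊤)
    (hsub : ∀ i, V i ⊆ Metric.closedBall (c i) r)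
    (hvisit : ∀ i, ((γ '' Set.Icc 0 1) ∩ V i).Nonempty) :
    (k : ℝ) * Real.pi * ((∑ i : Fin k, rhoOf (V i)) / k) ^ 2
        ≤ ∑ i : Fin k, Real.pi * rhoOf (V i) ^ 2 ∧
      (∑ i : Fin k, Real.pi * rhoOf (V i) ^ 2) ≤ 4 * r * ℓ + 4 * Real.pi * r ^ 2 ∧
      (k : ℝ) ≤ 4 * r / (Real.pi * ((∑ i : Fin k, rhoOf (V i)) / k) ^ 2) *
          (ℓ + Real.pi * r) := by
  have hfirst : (k : ℝ) * Real.pi * ((∑ i : Fin k, rhoOf (V i)) / k) ^ 2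
      ≤ ∑ i : Fin k, Real.pi * rhoOf (V i) ^ 2 := by
    rcases Nat.eq_zero_or_pos k with rfl | hk
    · simp
    have hk' : (0 : ℝ) < k := Nat.cast_pos.2 hk
    have h := sq_sum_le_card_mul_sum_sq (s := Finset.univ) (f := fun i : Fin k => rhoOf (V i))
    rw [Finset.card_univ, Fintype.card_fin] at h
    rw [← Finset.mul_sum, mul_comm (k : ℝ), mul_assoc]
    refine mul_le_mul_of_nonneg_left ?_ Real.pi_pos.le
    rw [div_pow, ← mul_div_assoc, div_le_iff₀ (by positivity)]
    nlinarith
  have hsecond : (∑ i : Fin k, Real.pi * rhoOf (V i) ^ 2) ≤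
      4 * r * ℓ + 4 * Real.pi * r ^ 2 := by
    have hex : ∀ i, ∃ s ∈ Set.Icc (0 : ℝ) 1, γ s ∈ V i := by
      intro i
      obtain ⟨_, ⟨s, hs, rfl⟩, hsV⟩ := hvisit i
      exact ⟨s, hs, hsV⟩
    choose t ht htV using hex
    have hsub' : ∀ i, V i ⊆ closedBall (γ (t i)) (2 * r) := fun i x hx => by
      have h1 := mem_closedBall.1 (hsub i hx)
      have h2 := mem_closedBall'.1 (hsub i (htV i))
      exact mem_closedBall.2 ((dist_triangle x (c i) (γ (t i))).trans (by linarith))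
    have hvol : volume (⋃ i, V i) = ∑ i, volume (V i) := by
      rw [measure_iUnion (fun i j hij => hdisj i j hij) hmeas, tsum_fintype]
    have hle : ∑ i, volume (V i) ≤ ENNReal.ofReal ((2 * r) ^ 2 * Real.pi) +
        ENNReal.ofReal (2 * (2 * r)) * eVariationOn γ (Set.Icc 0 1) :=
      hvol ▸ (measure_mono (Set.iUnion_mono hsub')).trans
        (volume_iUnion_closedBall_path_le γ _ t ht (2 * r) (by positivity))
    have hmul : ENNReal.ofReal (2 * (2 * r)) * eVariationOn γ (Set.Icc 0 1) ≠ ⊤ :=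
      ENNReal.mul_ne_top ENNReal.ofReal_ne_top hrect
    have hreal := ENNReal.toReal_mono (ENNReal.add_ne_top.2 ⟨ENNReal.ofReal_ne_top, hmul⟩) hle
    rw [ENNReal.toReal_sum (fun i _ => (hfin i).ne),
      ENNReal.toReal_add ENNReal.ofReal_ne_top hmul, ENNReal.toReal_mul, ← hlen,
      ENNReal.toReal_ofReal (by positivity), ENNReal.toReal_ofReal (by positivity)] at hreal
    simp_rw [pi_mul_rhoOf_sq]
    linarith
  refine ⟨hfirst, hsecond, ?_⟩
  rcases Nat.eq_zero_or_pos k with rfl | hk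
  · simp
  have hk' : (0 : ℝ) < k := Nat.cast_pos.2 hk
  have hρ : ∀ i, 0 < rhoOf (V i) := fun i =>
    Real.sqrt_pos.2 (div_pos (ENNReal.toReal_pos (hpos i).ne' (hfin i).ne) Real.pi_pos)
  have hsum : 0 < ∑ i : Fin k, rhoOf (V i) :=
    Finset.sum_pos (fun i _ => hρ i) ⟨⟨0, hk⟩, Finset.mem_univ _⟩
  have hden : 0 < Real.pi * ((∑ i : Fin k, rhoOf (V i)) / k) ^ 2 := by positivity
  rw [div_mul_eq_mul_div, le_div_iff₀ hden]
  linarith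
end

section
/- Let r > 0 and let T₁, T₂, T₃ ∈ ℝ² satisfy ‖T_i − T_j‖ ≥ 2r for all i ≠ j. Define l_TSP(T₁,T₂,T₃) = min( ‖T₂ − T₁‖ + ‖T₃ − T₂‖, ‖T₃ − T₁‖ + ‖T₂ − T₃‖ ), the shortest path through the three targets starting at T₁, and define l_opt(T₁,T₂,T₃) as the infimum of the lengths of continuous rectifiable paths starting at T₁ whose image intersects both closed discs B(T₂, r) and B(T₃, r). Let E₁ = (0,0), E₂ = (2r, 0), E₃ = (r, √3·r) be the vertices of an equilateral triangle of side 2r. Then l_TSP(T₁,T₂,T₃) / l_opt(T₁,T₂,T₃) ≤ l_TSP(E₁,E₂,E₃) / l_opt(E₁,E₂,E₃) = 4r / l_opt(E₁,E₂,E₃); that is, among all three-target configurations with non-overlapping sensing discs, the ratio of the shortest target-visiting path to the shortest coverage path is maximized by the tightly packed equilateral triangle configuration. -/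
open Metric Set

/-- Length of the shortest path through three targets starting at `T₁`:
the minimum of visiting `T₂` then `T₃`, or `T₃` then `T₂`. -/
noncomputable def tspLen3 (T₁ T₂ T₃ : EuclideanSpace ℝ (Fin 2)) : ℝ :=
  min (‖T₂ - T₁‖ + ‖T₃ - T₂‖) (‖T₃ - T₁‖ + ‖T₂ - T₃‖)

/-- Length of the optimal coverage path for three targets: the infimum of the lengths
of continuous rectifiable paths starting at `T₁` whose image meets both closed discs
`B(T₂, r)` and `B(T₃, r)`. -/
noncomputable def coverLen3 (r : ℝ) (T₁ T₂ T₃ : EuclideanSpace ℝ (Fin 2)) : ℝ :=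
  sInf {L : ℝ | ∃ γ : ℝ → EuclideanSpace ℝ (Fin 2),
    ContinuousOn γ (Set.Icc 0 1) ∧
    eVariationOn γ (Set.Icc 0 1) ≠ ⊤ ∧
    L = (eVariationOn γ (Set.Icc 0 1)).toReal ∧
    γ 0 = T₁ ∧
    ((γ '' Set.Icc 0 1) ∩ Metric.closedBall T₂ r).Nonempty ∧
    ((γ '' Set.Icc 0 1) ∩ Metric.closedBall T₃ r).Nonempty}

/-- Half the least value of `‖p‖ + ‖p - E₃‖` over the unit disc around `E₂`, for the equilateral
triangle of side `2` with vertices `0`, `E₂`, `E₃`. -/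
noncomputable def optLeg : ℝ := Real.sqrt (5 - 2 * Real.sqrt 3)

lemma sqrt_three_bounds : 1.73 ≤ Real.sqrt 3 ∧ Real.sqrt 3 ≤ 1.733 :=
  ⟨Real.le_sqrt_of_sq_le (by norm_num), Real.sqrt_le_iff.2 (by norm_num)⟩

lemma optLeg_sq : optLeg ^ 2 = 5 - 2 * Real.sqrt 3 :=
  Real.sq_sqrt (by linarith [sqrt_three_bounds.2])

lemma optLeg_bounds : 1.2 ≤ optLeg ∧ optLeg ≤ 1.25 := by
  obtain ⟨h1, h2⟩ := sqrt_three_bounds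
  exact ⟨Real.le_sqrt_of_sq_le (by norm_num; linarith),
    Real.sqrt_le_iff.2 ⟨by norm_num, by norm_num; linarith⟩⟩

/-- The scalar inequality behind the bound on two-leg paths: `g` is twice the cosine of half the
angle between the legs, and `τ` is the displacement of the middle point along the bisector. -/
lemma le_of_sq_bisector_le {m g τ F : ℝ} (hm : 4 ≤ m) (hg : 0 ≤ g) (hg2 : g ^ 2 ≤ 1 + m / 2)
    (hτ : |τ| ≤ 1) (hF : 0 ≤ F) (hF2 : m ^ 2 + 2 * m * g * τ + 4 * τ ^ 2 ≤ F ^ 2) :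
    1 + (2 * optLeg - 1) / 4 * m ≤ F := by
  obtain ⟨h1, h2⟩ := sqrt_three_bounds
  obtain ⟨s1, s2⟩ := optLeg_bounds
  have hs := optLeg_sq
  have h3 : Real.sqrt 3 ^ 2 = 3 := Real.sq_sqrt (by norm_num)
  set q := Real.sqrt 3
  set s := optLeg
  obtain ⟨t, rfl⟩ : ∃ t, m = 4 + t := ⟨m - 4, by ring⟩
  have ht : 0 ≤ t := by linarith
  obtain ⟨τ1, τ2⟩ := abs_le.1 hτ
  have hgG : g ≤ q * (1 + t / 12) := by
    refine le_of_sq_le_sq ?_ (by positivity)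
    have : (q * (1 + t / 12)) ^ 2 = 3 * (1 + t / 12) ^ 2 := by rw [mul_pow, h3]
    nlinarith [sq_nonneg t]
  set C := (4 + t) * (q * (1 + t / 12)) with hC
  have hC4 : 4 ≤ C := by
    have : 1 ≤ q * (1 + t / 12) := by nlinarith
    nlinarith
  have hgC : (4 + t) * g ≤ C := mul_le_mul_of_nonneg_left hgG (by linarith)
  have hg0 : 0 ≤ (4 + t) * g := by positivity
  have key : (4 + t) ^ 2 + 4 - 2 * C ≤ F ^ 2 := by
    refine le_trans ?_ hF2
    rcases le_total 0 τ with h | h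
    · nlinarith [mul_nonneg hg0 h, sq_nonneg τ]
    · nlinarith [mul_le_mul_of_nonpos_right hgC h,
        mul_nonneg (by linarith : 0 ≤ 1 + τ) (by linarith : 0 ≤ 2 * C - 4 * (1 - τ))]
  refine le_of_sq_le_sq (le_trans ?_ key) hF
  have e1 : (1 + (2 * s - 1) / 4 * (4 + t)) ^ 2
      = 4 * s ^ 2 + s * (2 * s - 1) * t + ((2 * s - 1) / 4) ^ 2 * t ^ 2 := by ring
  have e2 : (4 + t) ^ 2 + 4 - 2 * C
      = (20 - 8 * q) + (8 - 8 * q / 3) * t + (1 - q / 6) * t ^ 2 := by rw [hC]; ring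
  rw [e1, e2, hs]
  have c1 : s * (2 * s - 1) ≤ 8 - 8 * q / 3 := by nlinarith
  have c2 : ((2 * s - 1) / 4) ^ 2 ≤ 1 - q / 6 := by nlinarith
  nlinarith [mul_le_mul_of_nonneg_right c1 ht, mul_le_mul_of_nonneg_right c2 (sq_nonneg t)]

section InnerProductSpace

variable {E : Type*} [NormedAddCommGroup E] [InnerProductSpace ℝ E]

/-- Lower bound for two-leg paths through a point of the unit ball, obtained by reflecting the
second leg in the bisector of the angle spanned by `x` and `y`. -/
lemma le_norm_add_add_norm_add {x y v : E} (hv : ‖v‖ ≤ 1) (hx : 2 ≤ ‖x‖) (hy : 2 ≤ ‖y‖)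
    (hxy : 2 ≤ ‖x - y‖) :
    1 + (2 * optLeg - 1) / 4 * (‖x‖ + ‖y‖) ≤ ‖x + v‖ + ‖y + v‖ := by
  obtain ⟨a, ha⟩ : ∃ a, a = ‖x‖ := ⟨_, rfl⟩
  obtain ⟨c, hc⟩ : ∃ c, c = ‖y‖ := ⟨_, rfl⟩
  rw [← ha] at hx ⊢
  rw [← hc] at hy ⊢
  have ha0 : a ≠ 0 := by linarith
  have hc0 : c ≠ 0 := by linarith
  obtain ⟨x', hx'⟩ : ∃ x', x' = a⁻¹ • x := ⟨_, rfl⟩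
  obtain ⟨y', hy'⟩ : ∃ y', y' = c⁻¹ • y := ⟨_, rfl⟩
  have ex : x = a • x' := by rw [hx', smul_inv_smul₀ ha0]
  have ey : y = c • y' := by rw [hy', smul_inv_smul₀ hc0]
  have nx : ‖x'‖ = 1 := by
    rw [hx', norm_smul, norm_inv, Real.norm_of_nonneg (by linarith), ← ha, inv_mul_cancel₀ ha0]
  have ny : ‖y'‖ = 1 := by
    rw [hy', norm_smul, norm_inv, Real.norm_of_nonneg (by linarith), ← hc, inv_mul_cancel₀ hc0]
  obtain ⟨ρ, hρ⟩ : ∃ ρ : ℝ, ρ = inner ℝ x' y' := ⟨_, rfl⟩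
  obtain ⟨g, hg⟩ : ∃ g, g = ‖x' + y'‖ := ⟨_, rfl⟩
  have hg0 : 0 ≤ g := hg ▸ norm_nonneg _
  have hg2 : g ^ 2 = 2 + 2 * ρ := by
    rw [hg, norm_add_sq_real, nx, ny, hρ]; ring
  have hb : ‖x - y‖ ^ 2 = a ^ 2 + c ^ 2 - 2 * (a * c * ρ) := by
    have hin : inner ℝ x y = a * (c * ρ) := by
      rw [ex, ey, real_inner_smul_left, real_inner_smul_right, hρ]
    rw [norm_sub_sq_real, ← ha, ← hc, hin]
    ring
  have hρle : ρ ≤ (a + c - 2) / 4 := by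
    have h1 : a * c * ρ ≤ a * c * ((a + c - 2) / 4) := by
      have h4 : 4 ≤ ‖x - y‖ ^ 2 := by nlinarith
      nlinarith [mul_nonneg (sub_nonneg.2 hx) (sub_nonneg.2 hy),
        mul_nonneg (mul_nonneg (sub_nonneg.2 hx) (sub_nonneg.2 hy)) (sub_nonneg.2 hx),
        mul_nonneg (mul_nonneg (sub_nonneg.2 hx) (sub_nonneg.2 hy)) (sub_nonneg.2 hy)]
    exact le_of_mul_le_mul_left h1 (by positivity)
  rcases hg0.eq_or_lt with h0 | hpos
  · have hxy' : ‖x - y‖ = a + c := by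
      have : ρ = -1 := by rw [← h0] at hg2; linarith
      rw [this] at hb
      exact (sq_eq_sq₀ (norm_nonneg _) (by linarith)).1 (by rw [hb]; ring)
    have htri : ‖x - y‖ ≤ ‖x + v‖ + ‖y + v‖ := by
      simpa using norm_sub_le (x + v) (y + v)
    obtain ⟨s1, s2⟩ := optLeg_bounds
    nlinarith
  obtain ⟨e, he⟩ : ∃ e, e = g⁻¹ • (x' + y') := ⟨_, rfl⟩
  have ege : x' + y' = g • e := by rw [he, smul_inv_smul₀ hpos.ne']
  have ne : ‖e‖ = 1 := by
    rw [he, norm_smul, norm_inv, Real.norm_of_nonneg hg0, ← hg, inv_mul_cancel₀ hpos.ne']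
  have hyx : inner ℝ y' x' = ρ := by rw [hρ, real_inner_comm]
  have iex : inner ℝ e x' = g / 2 := by
    rw [he, real_inner_smul_left, inner_add_left, real_inner_self_eq_norm_sq, nx, hyx]
    field_simp; linarith
  have iey : inner ℝ e y' = g / 2 := by
    rw [he, real_inner_smul_left, inner_add_left, real_inner_self_eq_norm_sq, ny, ← hρ]
    field_simp; linarith
  have hrefl : ∀ w : E, ‖(2 * inner ℝ e w : ℝ) • e - w‖ = ‖w‖ := by
    intro w
    refine (sq_eq_sq₀ (norm_nonneg _) (norm_nonneg _)).1 ?_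
    rw [norm_sub_sq_real, norm_smul, ne, real_inner_smul_left, Real.norm_eq_abs, mul_one, sq_abs]
    ring
  obtain ⟨τ, hτ⟩ : ∃ τ : ℝ, τ = inner ℝ e v := ⟨_, rfl⟩
  have hτ1 : |τ| ≤ 1 := by
    rw [hτ]; exact (abs_real_inner_le_norm e v).trans (by rw [ne, one_mul]; exact hv)
  have hsum : (x + v) + ((2 * inner ℝ e (y + v) : ℝ) • e - (y + v))
      = (a + c) • x' + (2 * τ) • e := by
    rw [inner_add_right, ← hτ, ey, real_inner_smul_right, iey, ex,
      show (2 * (c * (g / 2) + τ)) • e = c • (g • e) + (2 * τ) • e by module, ← ege]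
    module
  have hle : ‖(a + c) • x' + (2 * τ) • e‖ ≤ ‖x + v‖ + ‖y + v‖ := by
    rw [← hsum, ← hrefl (y + v)]; exact norm_add_le _ _
  have hsq : ‖(a + c) • x' + (2 * τ) • e‖ ^ 2
      = (a + c) ^ 2 + 2 * (a + c) * g * τ + 4 * τ ^ 2 := by
    rw [norm_add_sq_real, norm_smul, norm_smul, nx, ne, real_inner_smul_left,
      real_inner_smul_right, real_inner_comm, iex, Real.norm_eq_abs, Real.norm_eq_abs,
      mul_one, mul_one, sq_abs, sq_abs]
    ring
  refine le_of_sq_bisector_le (by linarith) hg0 (by rw [hg2]; linarith) hτ1 (by positivity) ?_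
  rw [← hsq]
  exact pow_le_pow_left₀ (norm_nonneg _) hle 2

/-- Lower bound for the length of a two-leg path `o → p → q` meeting the balls around `A` and `B`
in this order. -/
lemma le_norm_two_legs {r : ℝ} (hr : 0 < r) {o A B p q : E} (hA : 2 * r ≤ ‖A - o‖)
    (hB : 2 * r ≤ ‖o - B‖) (hAB : 2 * r ≤ ‖A - B‖) (hp : ‖p - A‖ ≤ r) (hq : ‖q - B‖ ≤ r) :
    (2 * optLeg - 1) / 4 * (‖A - o‖ + ‖A - B‖) ≤ ‖p - o‖ + ‖q - p‖ := by
  have hn : ∀ w : E, ‖r⁻¹ • w‖ = ‖w‖ / r := fun w => by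
    rw [norm_smul, norm_inv, Real.norm_of_nonneg hr.le, inv_mul_eq_div]
  have h := le_norm_add_add_norm_add (x := r⁻¹ • (A - o)) (y := r⁻¹ • (A - B))
    (v := r⁻¹ • (p - A)) (by rw [hn, div_le_one hr]; exact hp)
    (by rw [hn, le_div_iff₀ hr]; exact hA) (by rw [hn, le_div_iff₀ hr]; exact hAB)
    (by rw [← smul_sub, hn, le_div_iff₀ hr, sub_sub_sub_cancel_left, norm_sub_rev]; exact hB)
  rw [← smul_add, ← smul_add, hn, hn, hn, hn, sub_add_sub_cancel', sub_add_sub_cancel',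
    ← add_div, ← add_div, ← mul_div_assoc, ← le_sub_iff_add_le', div_le_iff₀ hr, sub_mul,
    div_mul_cancel₀ _ hr.ne'] at h
  have htri : ‖p - B‖ ≤ ‖q - B‖ + ‖q - p‖ := by
    simpa [norm_sub_rev] using norm_sub_le (q - B) (q - p)
  linarith

/-- The two-leg polygonal path `o → p → q`, parametrized by `[0, 1]`. -/
lemma exists_path_two_legs (o p q : E) :
    ∃ γ : ℝ → E, ContinuousOn γ (Icc 0 1) ∧ γ 0 = o ∧ p ∈ γ '' Icc 0 1 ∧ q ∈ γ '' Icc 0 1 ∧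
      eVariationOn γ (Icc 0 1) ≤ ENNReal.ofReal (‖p - o‖ + ‖q - p‖) := by
  have haff : ∀ (z w : E) (a b : ℝ), a ≤ b →
      eVariationOn (fun t : ℝ => z + t • w) (Icc a b) ≤ ENNReal.ofReal (‖w‖ * (b - a)) := by
    intro z w a b hab
    have hL : LipschitzOnWith ‖w‖₊ (fun t : ℝ => z + t • w) univ := by
      refine LipschitzWith.lipschitzOnWith (LipschitzWith.of_dist_le_mul fun s t => ?_)
      rw [dist_add_left, dist_eq_norm, ← sub_smul, norm_smul, dist_eq_norm, mul_comm, coe_nnnorm]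
    have h1 := hL.comp_eVariationOn_le (g := (id : ℝ → ℝ)) (s := Icc a b) (mapsTo_univ _ _)
    have h2 := (monotone_id.monotoneOn (Icc a b)).eVariationOn_eq
      (left_mem_Icc.2 hab) (right_mem_Icc.2 hab)
    rw [inter_self] at h2
    refine h1.trans ((mul_le_mul_right h2.le _).trans_eq ?_)
    rw [ENNReal.ofReal_mul (norm_nonneg _), ← coe_nnnorm, ENNReal.ofReal_coe_nnreal]
    rfl
  let γ : ℝ → E := fun t => o + (2 * min t (1 / 2)) • (p - o) + max (2 * t - 1) 0 • (q - p)
  have hcont : Continuous γ := by fun_prop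
  have hmid : γ (1 / 2) = p := by simp [γ]
  have hend : γ 1 = q := by
    have : min (1 : ℝ) (1 / 2) = 1 / 2 := by norm_num
    simp only [γ, this]
    norm_num
  refine ⟨γ, hcont.continuousOn, by simp [γ], ⟨1 / 2, by norm_num, hmid⟩,
    ⟨1, by norm_num, hend⟩, ?_⟩
  have hsplit := eVariationOn.Icc_add_Icc γ (s := univ) (a := 0) (b := 1 / 2) (c := 1)
    (by norm_num) (by norm_num) (mem_univ _)
  simp only [univ_inter] at hsplit
  rw [← hsplit, ENNReal.ofReal_add (norm_nonneg _) (norm_nonneg _)]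
  refine add_le_add ?_ ?_
  · have heq : EqOn γ (fun t : ℝ => o + t • ((2 : ℝ) • (p - o))) (Icc 0 (1 / 2)) := by
      intro t ht
      simp only [γ]
      rw [min_eq_left ht.2, max_eq_right (by linarith [ht.2])]
      module
    rw [eVariationOn.eq_of_eqOn heq]
    refine (haff _ _ _ _ (by norm_num)).trans_eq ?_
    rw [norm_smul, Real.norm_ofNat]
    congr 1; ring
  · have heq : EqOn γ (fun t : ℝ => (p - (q - p)) + t • ((2 : ℝ) • (q - p))) (Icc (1 / 2) 1) := by
      intro t ht
      simp only [γ]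
      rw [min_eq_right ht.1, max_eq_left (by linarith [ht.1])]
      module
    rw [eVariationOn.eq_of_eqOn heq]
    refine (haff _ _ _ _ (by norm_num)).trans_eq ?_
    rw [norm_smul, Real.norm_ofNat]
    congr 1; ring

end InnerProductSpace

/-- A path of finite length is at least as long as a two-leg polygonal path inscribed in it. -/
lemma norm_two_legs_le_eVariationOn {E : Type*} [SeminormedAddCommGroup E] {γ : ℝ → E}
    (hfin : eVariationOn γ (Icc 0 1) ≠ ⊤) {s t : ℝ} (hs : 0 ≤ s) (hst : s ≤ t) (ht : t ≤ 1) :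
    ‖γ s - γ 0‖ + ‖γ t - γ s‖ ≤ (eVariationOn γ (Icc 0 1)).toReal := by
  have hsplit := eVariationOn.Icc_add_Icc γ (s := univ) hs hst (mem_univ _)
  simp only [univ_inter] at hsplit
  have h1 : edist (γ s) (γ 0) ≤ eVariationOn γ (Icc 0 s) :=
    eVariationOn.edist_le γ (right_mem_Icc.2 hs) (left_mem_Icc.2 hs)
  have h2 : edist (γ t) (γ s) ≤ eVariationOn γ (Icc s t) :=
    eVariationOn.edist_le γ (right_mem_Icc.2 hst) (left_mem_Icc.2 hst)
  have h3 : edist (γ s) (γ 0) + edist (γ t) (γ s) ≤ eVariationOn γ (Icc 0 1) :=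
    ((add_le_add h1 h2).trans_eq hsplit).trans (eVariationOn.mono γ (Icc_subset_Icc_right ht))
  have h4 := ENNReal.toReal_mono hfin h3
  rwa [ENNReal.toReal_add (edist_ne_top _ _) (edist_ne_top _ _), ← dist_edist, ← dist_edist,
    dist_eq_norm, dist_eq_norm] at h4

/-- Every coverage path has length at least `(2 * optLeg - 1) / 4` times the length of the shortest
path through the targets. -/
lemma mul_tspLen3_le_eVariationOn {r : ℝ} (hr : 0 < r) {T₁ T₂ T₃ : EuclideanSpace ℝ (Fin 2)}
    (h12 : 2 * r ≤ ‖T₁ - T₂‖) (h13 : 2 * r ≤ ‖T₁ - T₃‖) (h23 : 2 * r ≤ ‖T₂ - T₃‖)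
    {γ : ℝ → EuclideanSpace ℝ (Fin 2)} (hfin : eVariationOn γ (Icc 0 1) ≠ ⊤) (h0 : γ 0 = T₁)
    (h2 : ((γ '' Icc 0 1) ∩ closedBall T₂ r).Nonempty)
    (h3 : ((γ '' Icc 0 1) ∩ closedBall T₃ r).Nonempty) :
    (2 * optLeg - 1) / 4 * tspLen3 T₁ T₂ T₃ ≤ (eVariationOn γ (Icc 0 1)).toReal := by
  obtain ⟨_, ⟨s, hs, rfl⟩, hs2⟩ := h2
  obtain ⟨_, ⟨t, ht, rfl⟩, ht3⟩ := h3
  rw [mem_closedBall, dist_eq_norm] at hs2 ht3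
  have hk : 0 ≤ (2 * optLeg - 1) / 4 := by linarith [optLeg_bounds.1]
  rcases le_total s t with hst | hst
  · have hlen := norm_two_legs_le_eVariationOn hfin hs.1 hst ht.2
    rw [h0] at hlen
    have h := le_norm_two_legs hr (by rwa [norm_sub_rev]) h13 h23 hs2 ht3
    refine (mul_le_mul_of_nonneg_left ?_ hk).trans (h.trans hlen)
    rw [norm_sub_rev T₂ T₃]
    exact min_le_left _ _
  · have hlen := norm_two_legs_le_eVariationOn hfin ht.1 hst hs.2
    rw [h0] at hlen
    have h := le_norm_two_legs hr (by rwa [norm_sub_rev]) h12 (by rwa [norm_sub_rev]) ht3 hs2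
    refine (mul_le_mul_of_nonneg_left ?_ hk).trans (h.trans hlen)
    rw [norm_sub_rev T₃ T₂]
    exact min_le_right _ _

/-- Any two points of the sensing discs give an upper bound for `coverLen3`. -/
lemma coverLen3_le {r : ℝ} {T₁ T₂ T₃ p q : EuclideanSpace ℝ (Fin 2)}
    (hp : p ∈ closedBall T₂ r) (hq : q ∈ closedBall T₃ r) :
    coverLen3 r T₁ T₂ T₃ ≤ ‖p - T₁‖ + ‖q - p‖ := by
  obtain ⟨γ, hc, h0, hγp, hγq, hvar⟩ := exists_path_two_legs T₁ p q
  refine le_trans (csInf_le ⟨0, ?_⟩ ⟨γ, hc, ne_top_of_le_ne_top ENNReal.ofReal_ne_top hvar, rfl,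
    h0, ⟨p, hγp, hp⟩, ⟨q, hγq, hq⟩⟩) (ENNReal.toReal_le_of_le_ofReal (by positivity) hvar)
  rintro _ ⟨_, _, _, rfl, _⟩
  exact ENNReal.toReal_nonneg

/-- `coverLen3` is at least `(2 * optLeg - 1) / 4` times `tspLen3` for separated targets. -/
lemma mul_tspLen3_le_coverLen3 {r : ℝ} (hr : 0 < r) {T₁ T₂ T₃ : EuclideanSpace ℝ (Fin 2)}
    (h12 : 2 * r ≤ ‖T₁ - T₂‖) (h13 : 2 * r ≤ ‖T₁ - T₃‖) (h23 : 2 * r ≤ ‖T₂ - T₃‖) :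
    (2 * optLeg - 1) / 4 * tspLen3 T₁ T₂ T₃ ≤ coverLen3 r T₁ T₂ T₃ := by
  refine le_csInf ?_ ?_
  · obtain ⟨γ, hc, h0, h2, h3, hvar⟩ := exists_path_two_legs T₁ T₂ T₃
    exact ⟨_, γ, hc, ne_top_of_le_ne_top ENNReal.ofReal_ne_top hvar, rfl, h0,
      ⟨T₂, h2, mem_closedBall_self hr.le⟩, ⟨T₃, h3, mem_closedBall_self hr.le⟩⟩
  · rintro _ ⟨γ, _, hfin, rfl, h0, h2, h3⟩
    exact mul_tspLen3_le_eVariationOn hr h12 h13 h23 hfin h0 h2 h3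

lemma norm_euclidean_two_eq {v : EuclideanSpace ℝ (Fin 2)} {c : ℝ} (hc : 0 ≤ c)
    (h : v 0 ^ 2 + v 1 ^ 2 = c ^ 2) : ‖v‖ = c := by
  rw [EuclideanSpace.norm_eq, Fin.sum_univ_two, Real.norm_eq_abs, Real.norm_eq_abs, sq_abs, sq_abs,
    h, Real.sqrt_sq hc]

/-- Among all three-target configurations with non-overlapping sensing discs of radius
`r`, the ratio of the shortest target-visiting path (starting at `T₁`) to the shortest
coverage path is maximized by the tightly packed equilateral triangle configuration
`E₁ = (0,0)`, `E₂ = (2r,0)`, `E₃ = (r, √3·r)`, whose TSP length is `4r`. -/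
theorem three_target_ratio_max_equilateral (r : ℝ) (hr : 0 < r)
    (T₁ T₂ T₃ : EuclideanSpace ℝ (Fin 2))
    (hsep12 : 2 * r ≤ ‖T₁ - T₂‖) (hsep13 : 2 * r ≤ ‖T₁ - T₃‖)
    (hsep23 : 2 * r ≤ ‖T₂ - T₃‖) :
    tspLen3 T₁ T₂ T₃ / coverLen3 r T₁ T₂ T₃ ≤
        tspLen3 ((WithLp.equiv 2 (Fin 2 → ℝ)).symm ![0, 0])
            ((WithLp.equiv 2 (Fin 2 → ℝ)).symm ![2 * r, 0])
            ((WithLp.equiv 2 (Fin 2 → ℝ)).symm ![r, Real.sqrt 3 * r]) /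
          coverLen3 r ((WithLp.equiv 2 (Fin 2 → ℝ)).symm ![0, 0])
            ((WithLp.equiv 2 (Fin 2 → ℝ)).symm ![2 * r, 0])
            ((WithLp.equiv 2 (Fin 2 → ℝ)).symm ![r, Real.sqrt 3 * r]) ∧
      tspLen3 ((WithLp.equiv 2 (Fin 2 → ℝ)).symm ![0, 0])
          ((WithLp.equiv 2 (Fin 2 → ℝ)).symm ![2 * r, 0])
          ((WithLp.equiv 2 (Fin 2 → ℝ)).symm ![r, Real.sqrt 3 * r]) = 4 * r := by
  have h3 : Real.sqrt 3 ^ 2 = 3 := Real.sq_sqrt (by norm_num)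
  have hs := optLeg_sq
  obtain ⟨s1, s2⟩ := optLeg_bounds
  set E₁ : EuclideanSpace ℝ (Fin 2) := (WithLp.equiv 2 (Fin 2 → ℝ)).symm ![0, 0] with hE₁
  set E₂ : EuclideanSpace ℝ (Fin 2) := (WithLp.equiv 2 (Fin 2 → ℝ)).symm ![2 * r, 0] with hE₂
  set E₃ : EuclideanSpace ℝ (Fin 2) :=
    (WithLp.equiv 2 (Fin 2 → ℝ)).symm ![r, Real.sqrt 3 * r] with hE₃
  have h2r : 0 ≤ 2 * r := by linarith
  have d12 : ‖E₁ - E₂‖ = 2 * r := norm_euclidean_two_eq h2r (by simp [hE₁, hE₂])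
  have d13 : ‖E₁ - E₃‖ = 2 * r :=
    norm_euclidean_two_eq h2r (by simp [hE₁, hE₃]; linear_combination r ^ 2 * h3)
  have d23 : ‖E₂ - E₃‖ = 2 * r :=
    norm_euclidean_two_eq h2r (by simp [hE₂, hE₃]; linear_combination r ^ 2 * h3)
  have htsp : tspLen3 E₁ E₂ E₃ = 4 * r := by
    rw [tspLen3, norm_sub_rev E₂ E₁, norm_sub_rev E₃ E₂, norm_sub_rev E₃ E₁, d12, d13, d23,
      min_self]
    ring
  refine ⟨?_, htsp⟩
  have hlow := mul_tspLen3_le_coverLen3 hr hsep12 hsep13 hsep23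
  have hlowE := mul_tspLen3_le_coverLen3 hr d12.ge d13.ge d23.ge
  have hk : 0 < (2 * optLeg - 1) / 4 := by linarith
  rw [htsp] at hlowE ⊢
  have hupE : coverLen3 r E₁ E₂ E₃ ≤ (2 * optLeg - 1) * r := by
    let p : EuclideanSpace ℝ (Fin 2) := !₂[(2 - Real.sqrt 3 / 2) * r, r / 2]
    have hpE₂ : ‖p - E₂‖ = r :=
      norm_euclidean_two_eq hr.le (by simp [p, hE₂]; linear_combination r ^ 2 / 4 * h3)
    have hpE₁ : ‖p - E₁‖ = optLeg * r := norm_euclidean_two_eq (by positivity) (by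
      simp [p, hE₁]; linear_combination r ^ 2 / 4 * h3 - r ^ 2 * hs)
    have hpE₃ : ‖p - E₃‖ = optLeg * r := norm_euclidean_two_eq (by positivity) (by
      simp [p, hE₃]; linear_combination r ^ 2 * 5 / 4 * h3 - r ^ 2 * hs)
    have hs0 : optLeg ≠ 0 := by linarith
    have hq : ‖E₃ + optLeg⁻¹ • (p - E₃) - E₃‖ = r := by
      rw [add_sub_cancel_left, norm_smul, norm_inv, Real.norm_of_nonneg (by linarith), hpE₃,
        inv_mul_cancel_left₀ hs0]
    have hqp : ‖E₃ + optLeg⁻¹ • (p - E₃) - p‖ = (optLeg - 1) * r := by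
      have hinv : optLeg⁻¹ ≤ 1 := inv_le_one_of_one_le₀ (by linarith)
      rw [show E₃ + optLeg⁻¹ • (p - E₃) - p = -((1 - optLeg⁻¹) • (p - E₃)) by module, norm_neg,
        norm_smul, Real.norm_of_nonneg (by linarith), hpE₃]
      field_simp
    have h := coverLen3_le (T₁ := E₁) (mem_closedBall_iff_norm.2 hpE₂.le)
      (mem_closedBall_iff_norm.2 hq.le)
    rw [hpE₁, hqp] at h
    linarith
  have hE0 : 0 < coverLen3 r E₁ E₂ E₃ := lt_of_lt_of_le (by positivity) hlowE
  have htsp0 : 0 < tspLen3 T₁ T₂ T₃ :=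
    lt_min (by rw [norm_sub_rev T₂]; linarith [norm_nonneg (T₃ - T₂)])
      (by rw [norm_sub_rev T₃]; linarith [norm_nonneg (T₂ - T₃)])
  have h0 : 0 < coverLen3 r T₁ T₂ T₃ := lt_of_lt_of_le (by positivity) hlow
  rw [div_le_div_iff₀ h0 hE0]
  calc tspLen3 T₁ T₂ T₃ * coverLen3 r E₁ E₂ E₃
      ≤ tspLen3 T₁ T₂ T₃ * ((2 * optLeg - 1) * r) := mul_le_mul_of_nonneg_left hupE htsp0.le
    _ = 4 * r * ((2 * optLeg - 1) / 4 * tspLen3 T₁ T₂ T₃) := by ring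
    _ ≤ 4 * r * coverLen3 r T₁ T₂ T₃ := mul_le_mul_of_nonneg_left hlow (by linarith)
end
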